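/- Let α < 1/2. Every finite positive Borel measure μ on [0,∞) is uniquely determined by its index Whittaker transform: if μ₁, μ₂ are finite positive Borel measures on [0,∞) with μ̂₁(λ) = μ̂₂(λ) for all λ ≥ 0, then μ₁ = μ₂. -/

import Mathlib

open MeasureTheory Measure Set Filter Topology

noncomputable section

/-- The Pochhammer symbol `(a)ₙ`. -/
def poch (a : ℂ) (n : ℕ) : ℂ := ∏ i ∈ Finset.range n, (a + i)

/-- Kummer's confluent hypergeometric function `M(a,b;z)` (power series). -/
def kummerM (a b z : ℂ) : ℂ := ∑' n : ℕ, poch a n / poch b n * z ^ n / (n.factorial : ℂ)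

/-- Tricomi's confluent hypergeometric function `Ψ(a,b;z)`. -/
def tricomiU (a b z : ℂ) : ℂ :=
  Complex.Gamma (1 - b) / Complex.Gamma (a + 1 - b) * kummerM a b z
    + Complex.Gamma (b - 1) / Complex.Gamma a * z ^ ((1 : ℂ) - b) * kummerM (a - b + 1) (2 - b) z

/-- The parabolic cylinder function `D_μ(z)` (real argument). -/
def cylinderD (μ : ℂ) (z : ℝ) : ℂ :=
  (2 : ℂ) ^ (μ / 2) * Complex.exp (-(z : ℂ) ^ 2 / 4) * tricomiU (-μ / 2) (1 / 2) ((z : ℂ) ^ 2 / 2)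

/-- The Whittaker function of the second kind `W_{κ,ν}(z)` (positive real argument). -/
def whittakerW (κ ν : ℂ) (z : ℝ) : ℂ :=
  Complex.exp (-(z : ℂ) / 2) * (z : ℂ) ^ ((1 : ℂ) / 2 + ν) * tricomiU (1 / 2 - κ + ν) (1 + 2 * ν) z

/-- The modified Whittaker-type kernel `𝑾_{α,ν}(x) = 2^α x^{2α} e^{1/(4x²)} W_{α,ν}(1/(2x²))`,
extended continuously by `𝑾_{α,ν}(0) = 1`. -/
def bW (α ν : ℂ) (x : ℝ) : ℂ :=
  if x = 0 then 1
  else (2 : ℂ) ^ α * (x : ℂ) ^ (2 * α) * Complex.exp (1 / (4 * (x : ℂ) ^ 2)) *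
      whittakerW α ν (1 / (2 * x ^ 2))

/-- Real-valued version of `𝑾_{α,ν}(x)` (real `α`; `𝑾` is real for the relevant `ν`). -/
def bWr (α : ℝ) (ν : ℂ) (x : ℝ) : ℝ := (bW α ν x).re

/-- `Δ_λ := √((1/2 − α)² − λ)` (principal square root, so `= i√(λ − (1/2 − α)²)` for large λ). -/
def Δl (α lam : ℝ) : ℂ := ((((1 / 2 - α) ^ 2 - lam : ℝ) : ℂ)) ^ ((1 : ℂ) / 2)

/-- The weight `m(x) = x^{1−4α} e^{−1/(2x²)}`. -/
def mw (α x : ℝ) : ℝ := x ^ (1 - 4 * α) * Real.exp (-1 / (2 * x ^ 2))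

/-- The measure `m(x) dx` on `(0,∞)`. -/
def mMeas (α : ℝ) : Measure ℝ :=
  (volume.restrict (Ioi 0)).withDensity fun x => ENNReal.ofReal (mw α x)

/-- Real-valued parabolic cylinder function. -/
def Dr (μ z : ℝ) : ℝ := (cylinderD μ z).re

/-- The kernel `q(x,y,ξ)` of the index Whittaker product formula. -/
def qk (α x y ξ : ℝ) : ℝ :=
  (2 * Real.pi) ^ (-(1 : ℝ) / 2) * (x * y * ξ) ^ (-1 + 2 * α) *
    Real.exp (1 / (2 * x ^ 2) + 1 / (2 * y ^ 2) + 1 / (2 * ξ ^ 2)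
      - ((x ^ 2 + y ^ 2 + ξ ^ 2) / (4 * x * y * ξ)) ^ 2) *
    Dr (2 * α) ((x ^ 2 + y ^ 2 + ξ ^ 2) / (2 * x * y * ξ))

/-- Index Whittaker transform of a measure. -/
def iwHat (α : ℝ) (μ : Measure ℝ) (lam : ℝ) : ℝ := ∫ x, bWr α (Δl α lam) x ∂μ

/-- Index Whittaker translation `(T^y f)(x)` for `x, y > 0`. -/
def translPos (α : ℝ) (f : ℝ → ℝ) (y x : ℝ) : ℝ :=
  ∫ ξ in Ioi (0 : ℝ), f ξ * qk α x y ξ * mw α ξ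

/-- Index Whittaker translation with the boundary conventions
`(T^x f)(0) = (T^0 f)(x) = f(x)`. -/
def transl (α : ℝ) (f : ℝ → ℝ) (y x : ℝ) : ℝ :=
  if x = 0 then f y else if y = 0 then f x else translPos α f y x

/-- The transition kernel `δ_x * δ_y` of the index Whittaker convolution. -/
def iwKernel (α x y : ℝ) : Measure ℝ :=
  if x = 0 then Measure.dirac y
  else if y = 0 then Measure.dirac x
  else (volume.restrict (Ioi 0)).withDensity fun ξ => ENNReal.ofReal (qk α x y ξ * mw α ξ)

/-- The index Whittaker convolution of two measures on `[0,∞)`. -/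
def iwConv (α : ℝ) (μ ν : Measure ℝ) : Measure ℝ :=
  (μ.prod ν).bind fun p => iwKernel α p.1 p.2

/-- `n`-fold index Whittaker convolution power. -/
def iwConvPow (α : ℝ) (μ : Measure ℝ) : ℕ → Measure ℝ
  | 0 => Measure.dirac 0
  | n + 1 => iwConv α (iwConvPow α μ n) μ

/-- A measure on `ℝ` is supported on the half-line `[0,∞)`. -/
def OnHalfLine (μ : Measure ℝ) : Prop := μ {x | x < 0} = 0

/-- `*`-infinite divisibility with respect to the index Whittaker convolution. -/
def IsIWInfDiv (α : ℝ) (μ : Measure ℝ) : Prop :=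
  IsProbabilityMeasure μ ∧ OnHalfLine μ ∧
    ∀ n : ℕ, 0 < n → ∃ ν : Measure ℝ,
      IsProbabilityMeasure ν ∧ OnHalfLine ν ∧ μ = iwConvPow α ν n

/-- The `*`-compound Poisson measure `e(aμ)`. -/
def iwCompoundPoisson (α a : ℝ) (μ : Measure ℝ) : Measure ℝ :=
  Measure.sum fun k : ℕ =>
    (ENNReal.ofReal (Real.exp (-a) * a ^ k / k.factorial)) • iwConvPow α μ k

/-- `*`-Gaussian measures. -/
def IsIWGaussian (α : ℝ) (μ : Measure ℝ) : Prop :=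
  IsIWInfDiv α μ ∧
    ∀ a : ℝ, 0 < a → ∀ ν ϑ : Measure ℝ, IsProbabilityMeasure ν → OnHalfLine ν →
      IsIWInfDiv α ϑ → μ = iwConv α (iwCompoundPoisson α a ν) ϑ → ν = Measure.dirac 0

/-- `*`-convolution semigroups. -/
structure IsIWConvSemigroup (α : ℝ) (μ : ℝ → Measure ℝ) : Prop where
  prob : ∀ t, 0 ≤ t → IsProbabilityMeasure (μ t)
  half : ∀ t, 0 ≤ t → OnHalfLine (μ t)
  conv : ∀ s t, 0 ≤ s → 0 ≤ t → μ (s + t) = iwConv α (μ s) (μ t)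
  zero : μ 0 = Measure.dirac 0
  cont : ∀ f : BoundedContinuousFunction ℝ ℝ,
    Tendsto (fun t => ∫ x, f x ∂(μ t)) (𝓝[>] (0 : ℝ)) (𝓝 (f 0))


/-- The integrand of Euler's integral for `Γ(s)` in the logarithmic variable `w`, scaled by
`exp β`. -/
def gammaKernel (s : ℂ) (β w : ℝ) : ℂ := Complex.exp (s * w - (Real.exp (w + β) : ℝ))

@[fun_prop]
lemma continuous_gammaKernel (s : ℂ) (β : ℝ) : Continuous (gammaKernel s β) := by
  unfold gammaKernel; fun_prop

lemma norm_gammaKernel (s : ℂ) (β w : ℝ) :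
    ‖gammaKernel s β w‖ = Real.exp (s.re * w - Real.exp (w + β)) := by
  simp only [gammaKernel, Complex.norm_exp, Complex.sub_re, Complex.mul_re, Complex.ofReal_re,
    Complex.ofReal_im, mul_zero, sub_zero]

lemma gammaKernel_ofReal (c β w : ℝ) :
    gammaKernel c β w = (Real.exp (c * w - Real.exp (w + β)) : ℝ) := by
  simp [gammaKernel]

lemma gammaKernel_zero_eq (s : ℂ) (w : ℝ) :
    gammaKernel s 0 w = |Real.exp w| • (((Real.exp (-Real.exp w) : ℝ) : ℂ) *
      ((Real.exp w : ℝ) : ℂ) ^ (s - 1)) := by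
  have h : ((Real.exp w : ℝ) : ℂ) ^ (s - 1) = Complex.exp (w * (s - 1)) := by
    rw [Complex.cpow_def_of_ne_zero (by exact_mod_cast Real.exp_ne_zero w),
      ← Complex.ofReal_log (Real.exp_pos w).le, Real.log_exp]
  rw [h, abs_of_pos (Real.exp_pos w), Complex.real_smul, gammaKernel, Complex.ofReal_exp w,
    Complex.ofReal_exp (-Real.exp w), ← Complex.exp_add, ← Complex.exp_add]
  congr 1
  push_cast
  simp
  ring

lemma integrable_gammaKernel {s : ℂ} (hs : 0 < s.re) (β : ℝ) : Integrable (gammaKernel s β) := by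
  have h0 : Integrable (gammaKernel s 0) := by
    have := Complex.GammaIntegral_convergent hs
    rw [← Real.range_exp, ← image_univ, integrableOn_image_iff_integrableOn_abs_deriv_smul
      MeasurableSet.univ (fun x _ ↦ (Real.hasDerivAt_exp x).hasDerivWithinAt)
      Real.exp_injective.injOn, integrableOn_univ] at this
    exact this.congr (ae_of_all _ fun w ↦ (gammaKernel_zero_eq s w).symm)
  refine ((h0.comp_add_right β).const_mul (Complex.exp (-s * β))).congr (ae_of_all _ fun w ↦ ?_)
  simp only [gammaKernel, ← Complex.exp_add]
  congr 1
  push_cast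
  simp
  ring

lemma integral_gammaKernel {s : ℂ} (hs : 0 < s.re) (β : ℝ) :
    ∫ w, gammaKernel s β w = Complex.exp (-s * β) * Complex.Gamma s := by
  have h0 : ∫ w, gammaKernel s 0 w = Complex.Gamma s := by
    rw [Complex.Gamma_eq_integral hs, Complex.GammaIntegral, ← Real.range_exp, ← image_univ,
      integral_image_eq_integral_abs_deriv_smul
      MeasurableSet.univ (fun x _ ↦ (Real.hasDerivAt_exp x).hasDerivWithinAt)
      Real.exp_injective.injOn, setIntegral_univ]
    simp_rw [gammaKernel_zero_eq]
  rw [← h0, ← integral_add_right_eq_self (gammaKernel s 0) β, ← integral_const_mul]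
  congr 1 with w
  simp only [gammaKernel, ← Complex.exp_add]
  congr 1
  push_cast
  simp
  ring

lemma integral_norm_gammaKernel {s : ℂ} (hs : 0 < s.re) (β : ℝ) :
    ∫ w, ‖gammaKernel s β w‖ = Real.exp (-s.re * β) * Real.Gamma s.re := by
  have h := integral_gammaKernel (s := (s.re : ℂ)) (by simpa using hs) β
  simp_rw [gammaKernel_ofReal, integral_complex_ofReal, Complex.Gamma_ofReal] at h
  simp_rw [norm_gammaKernel]
  exact_mod_cast h

lemma integrableOn_gammaKernel_Ioi (s : ℂ) (β : ℝ) : IntegrableOn (gammaKernel s β) (Ioi 0) := by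
  have h := (integrable_gammaKernel (s := ((|s.re| + 1 : ℝ) : ℂ))
    (by rw [Complex.ofReal_re]; positivity) β).integrableOn (s := Ioi 0)
  refine Integrable.mono h (continuous_gammaKernel s β).aestronglyMeasurable ?_
  filter_upwards [ae_restrict_mem measurableSet_Ioi] with w hw
  rw [norm_gammaKernel, norm_gammaKernel, Complex.ofReal_re]
  have : s.re * w ≤ (|s.re| + 1) * w :=
    mul_le_mul_of_nonneg_right ((le_abs_self _).trans (by linarith)) (le_of_lt hw)
  gcongr

lemma gammaKernel_add_one (s : ℂ) (β w : ℝ) :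
    gammaKernel (s + 1) β w = Complex.exp w * gammaKernel s β w := by
  simp only [gammaKernel, ← Complex.exp_add]
  congr 1
  ring

lemma hasDerivAt_gammaKernel (s : ℂ) (β w : ℝ) :
    HasDerivAt (gammaKernel s β)
      (s * gammaKernel s β w - Real.exp β * gammaKernel (s + 1) β w) w := by
  have h1 : HasDerivAt (fun w : ℝ ↦ s * (w : ℂ)) s w := by
    simpa using (Complex.ofRealCLM.hasDerivAt (x := w)).const_mul s
  have h2 : HasDerivAt (fun w : ℝ ↦ ((Real.exp (w + β) : ℝ) : ℂ)) ((Real.exp (w + β) : ℝ) : ℂ) w :=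
    by simpa using (((hasDerivAt_id w).add_const β).exp).ofReal_comp
  refine ((h1.sub h2).cexp).congr_deriv ?_
  rw [gammaKernel_add_one]
  simp only [gammaKernel, Real.exp_add, Pi.sub_apply]
  push_cast
  ring

/-- The upper incomplete gamma function in logarithmic form. -/
def upperGammaLog (s : ℂ) (β : ℝ) : ℂ := ∫ w in Ioi (0 : ℝ), gammaKernel s β w

lemma upperGammaLog_add_one (s : ℂ) (β : ℝ) :
    s * upperGammaLog s β - Real.exp β * upperGammaLog (s + 1) β =
      -Complex.exp (-(Real.exp β : ℝ)) := by
  have i1 := integrableOn_gammaKernel_Ioi s β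
  have i2 := integrableOn_gammaKernel_Ioi (s + 1) β
  have hd : IntegrableOn (fun w ↦ s * gammaKernel s β w - Real.exp β * gammaKernel (s + 1) β w)
      (Ioi 0) := (i1.const_mul s).sub (i2.const_mul _)
  have h := integral_Ioi_of_hasDerivAt_of_tendsto' (a := 0)
    (fun w _ ↦ hasDerivAt_gammaKernel s β w) hd
    (tendsto_zero_of_hasDerivAt_of_integrableOn_Ioi
      (fun w _ ↦ hasDerivAt_gammaKernel s β w) hd i1)
  rw [integral_sub (i1.const_mul s) (i2.const_mul _), integral_const_mul, integral_const_mul] at h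
  rw [upperGammaLog, upperGammaLog, h]
  simp [gammaKernel]

/-- The power series of the lower incomplete gamma function in logarithmic form. -/
def lowerGammaLog (s : ℂ) (β : ℝ) : ℂ :=
  ∑' m : ℕ, (-(Real.exp β : ℝ) : ℂ) ^ m / (m.factorial : ℂ) / (s + m)

lemma summable_pow_div_factorial_mul (z : ℂ) {f : ℕ → ℂ} {C : ℝ} (hf : ∀ m, ‖f m‖ ≤ C) :
    Summable fun m : ℕ ↦ z ^ m / (m.factorial : ℂ) * f m := by
  refine .of_norm_bounded ((Real.summable_pow_div_factorial ‖z‖).mul_right C) fun m ↦ ?_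
  rw [norm_mul, norm_div, norm_pow, Complex.norm_natCast]
  gcongr
  exact hf m

lemma norm_inv_add_natCast_le {s : ℂ} (hs : s.im ≠ 0) (m : ℕ) : ‖(s + m)⁻¹‖ ≤ |s.im|⁻¹ := by
  rw [norm_inv]
  refine inv_anti₀ (abs_pos.2 hs) ?_
  simpa using Complex.abs_im_le_norm (s + m)

lemma summable_lowerGammaLog {s : ℂ} (hs : s.im ≠ 0) (z : ℂ) :
    Summable fun m : ℕ ↦ z ^ m / (m.factorial : ℂ) / (s + m) :=
  summable_pow_div_factorial_mul z (norm_inv_add_natCast_le hs)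

lemma lowerGammaLog_add_one {s : ℂ} (hs : s.im ≠ 0) (β : ℝ) :
    s * lowerGammaLog s β - Real.exp β * lowerGammaLog (s + 1) β =
      Complex.exp (-(Real.exp β : ℝ)) := by
  have hs1 : (s + 1).im ≠ 0 := by simpa using hs
  set z : ℂ := -(Real.exp β : ℝ) with hz
  have hne (m : ℕ) : s + m ≠ 0 := fun h ↦ hs (by simpa using congrArg Complex.im h)
  have h1 : HasSum (fun m : ℕ ↦ s * (z ^ m / (m.factorial : ℂ) / (s + m)))
      (s * lowerGammaLog s β) := (summable_lowerGammaLog hs z).hasSum.mul_left s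
  have h2 : HasSum (fun m : ℕ ↦ z ^ m / (m.factorial : ℂ)) (Complex.exp z) := by
    rw [Complex.exp_eq_exp_ℂ]; exact NormedSpace.expSeries_div_hasSum_exp z
  have h3 : HasSum (fun m : ℕ ↦ z * (z ^ m / (m.factorial : ℂ) / (s + 1 + m)))
      (z * lowerGammaLog (s + 1) β) := (summable_lowerGammaLog hs1 z).hasSum.mul_left z
  have h4 := h2.sub h1
  rw [← hasSum_nat_add_iff' 1] at h4
  have h5 := h4.unique (h3.congr_fun ?_)
  · simp [mul_inv_cancel₀ (show s ≠ 0 by simpa using hne 0)] at h5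
    rw [hz] at h5 ⊢
    linear_combination -h5
  · intro m
    have := hne (m + 1)
    have h' : s + 1 + m ≠ 0 := by push_cast at this; rwa [add_assoc, add_comm (1 : ℂ)]
    have hm : (m.factorial : ℂ) ≠ 0 := by exact_mod_cast m.factorial_ne_zero
    have hm1 : (m : ℂ) + 1 ≠ 0 := by exact_mod_cast m.succ_ne_zero
    rw [Nat.factorial_succ]
    push_cast at this ⊢
    field_simp
    ring

lemma integral_gammaKernel_Iic {s : ℂ} (hs : 0 < s.re) (β : ℝ) :
    ∫ w in Iic (0 : ℝ), gammaKernel s β w = lowerGammaLog s β := by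
  set z : ℂ := -(Real.exp β : ℝ) with hz
  have hre (m : ℕ) : s.re ≤ (s + m).re := by simp
  have hpos (m : ℕ) : 0 < (s + m).re := hs.trans_le (hre m)
  have key := hasSum_integral_of_summable_integral_norm (μ := volume.restrict (Iic (0 : ℝ)))
    (F := fun (m : ℕ) (w : ℝ) ↦ z ^ m / (m.factorial : ℂ) * Complex.exp ((s + m) * w))
    (fun m ↦ (integrableOn_exp_mul_complex_Iic (hpos m) 0).const_mul _) ?_
  · have h1 (w : ℝ) : ∑' m : ℕ, z ^ m / (m.factorial : ℂ) * Complex.exp ((s + m) * w) =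
        gammaKernel s β w := by
      have h2 : HasSum (fun m : ℕ ↦ (z * Complex.exp w) ^ m / (m.factorial : ℂ))
          (Complex.exp (z * Complex.exp w)) := by
        rw [Complex.exp_eq_exp_ℂ]; exact NormedSpace.expSeries_div_hasSum_exp _
      have h3 := (h2.mul_left (Complex.exp (s * w))).tsum_eq
      refine Eq.trans ?_ (h3.trans ?_)
      · congr 1 with m
        rw [add_mul, Complex.exp_add, mul_pow, ← Complex.exp_nat_mul]
        ring
      · rw [← Complex.exp_add, gammaKernel, hz, Real.exp_add]
        congr 1
        push_cast
        ring
    simp_rw [h1] at key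
    rw [← key.tsum_eq, lowerGammaLog]
    congr 1 with m
    rw [integral_const_mul, integral_exp_mul_complex_Iic (hpos m)]
    simp [div_eq_mul_inv, hz]
  · have h3 (m : ℕ) : ∫ w in Iic (0 : ℝ), ‖z ^ m / (m.factorial : ℂ) * Complex.exp ((s + m) * w)‖ =
        ‖z‖ ^ m / m.factorial * (s + m).re⁻¹ := by
      have (w : ℝ) : ‖Complex.exp ((s + m) * w)‖ = Real.exp ((s + m).re * w) := by
        simp [Complex.norm_exp]
      simp_rw [norm_mul, norm_div, norm_pow, Complex.norm_natCast, this]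
      rw [integral_const_mul, integral_exp_mul_Iic (hpos m)]
      simp
    simp_rw [h3]
    refine .of_nonneg_of_le (fun m ↦ ?_) (fun m ↦ ?_)
      ((Real.summable_pow_div_factorial ‖z‖).mul_right s.re⁻¹)
    · have := hpos m
      positivity
    · exact mul_le_mul_of_nonneg_left (inv_anti₀ hs (hre m)) (by positivity)

lemma upperGammaLog_eq {s : ℂ} (hs : s.im ≠ 0) (β : ℝ) :
    upperGammaLog s β = Complex.exp (-s * β) * Complex.Gamma s - lowerGammaLog s β := by
  have base {s : ℂ} (hs : 0 < s.re) :
      upperGammaLog s β = Complex.exp (-s * β) * Complex.Gamma s - lowerGammaLog s β := by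
    rw [← integral_gammaKernel_Iic hs, ← integral_gammaKernel hs,
      ← setIntegral_univ, ← Set.Iic_union_Ioi (a := 0),
      setIntegral_union (Iic_disjoint_Ioi le_rfl) measurableSet_Ioi
        (integrable_gammaKernel hs β).integrableOn (integrable_gammaKernel hs β).integrableOn,
      upperGammaLog]
    ring
  obtain ⟨n, hn⟩ := exists_nat_gt (-s.re)
  induction n generalizing s with
  | zero => exact base (by simpa using hn)
  | succ n ih =>
    have hs1 : (s + 1).im ≠ 0 := by simpa using hs
    have hne : s ≠ 0 := fun h ↦ hs (by simp [h])
    have h := ih hs1 (by push_cast at hn; simp; linarith)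
    have h1 := upperGammaLog_add_one s β
    have h2 := lowerGammaLog_add_one hs β
    rw [h, Complex.Gamma_add_one s hne] at h1
    have h3 : Complex.exp (-s * β) = Real.exp β * Complex.exp (-(s + 1) * β) := by
      rw [Complex.ofReal_exp, ← Complex.exp_add]
      congr 1
      ring
    refine mul_left_cancel₀ hne ?_
    rw [h3]
    linear_combination h1 + h2

lemma poch_succ (a : ℂ) (n : ℕ) : poch a (n + 1) = poch a n * (a + n) := Finset.prod_range_succ _ _

lemma Gamma_add_natCast {a : ℂ} (ha : ∀ n : ℕ, a + n ≠ 0) (n : ℕ) :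
    Complex.Gamma (a + n) = poch a n * Complex.Gamma a := by
  induction n with
  | zero => simp [poch]
  | succ n ih =>
    push_cast
    rw [← add_assoc, Complex.Gamma_add_one _ (ha n), ih, poch_succ]
    ring

lemma poch_ne_zero {a : ℂ} (ha : ∀ n : ℕ, a + n ≠ 0) (n : ℕ) : poch a n ≠ 0 :=
  Finset.prod_ne_zero_iff.2 fun i _ ↦ ha i

lemma add_natCast_ne_zero {a : ℂ} (ha : a.im ≠ 0) (n : ℕ) : a + n ≠ 0 :=
  fun h ↦ ha (by simpa using congrArg Complex.im h)

lemma Gamma_sub_natCast {μ : ℂ} (hμ : μ.im ≠ 0) (n : ℕ) :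
    (-1) ^ n * Complex.Gamma (μ - n) = Complex.Gamma μ / poch (1 - μ) n := by
  have hne := poch_ne_zero (add_natCast_ne_zero (a := 1 - μ) (by simpa using hμ))
  rw [eq_div_iff (hne n)]
  induction n with
  | zero => simp [poch]
  | succ n ih =>
    have h0 : μ - (n + 1 : ℕ) ≠ 0 := fun h ↦ hμ (by simpa using congrArg Complex.im h)
    have h1 := Complex.Gamma_add_one _ h0
    have h2 : μ - (n + 1 : ℕ) + 1 = μ - n := by push_cast; ring
    rw [h2] at h1
    rw [← ih, poch_succ, h1]
    push_cast
    ring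

lemma factorial_le_norm_poch {a : ℂ} (ha : 1 ≤ a.re) (n : ℕ) : (n.factorial : ℝ) ≤ ‖poch a n‖ := by
  induction n with
  | zero => simp [poch]
  | succ n ih =>
    rw [poch_succ, norm_mul, Nat.factorial_succ, mul_comm]
    push_cast
    gcongr
    refine le_trans ?_ (Complex.re_le_norm _)
    simp
    linarith

/-- The integrand of `2 K_μ(2 exp β)` in the representation
`2 K_μ(2ρ) = ∫ exp (μ w - 2 ρ cosh w) dw`. -/
def besselKernel (μ : ℂ) (β w : ℝ) : ℂ :=
  Complex.exp (μ * w - (Real.exp (w + β) : ℝ) - (Real.exp (β - w) : ℝ))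

@[fun_prop]
lemma continuous_besselKernel (μ : ℂ) (β : ℝ) : Continuous (besselKernel μ β) := by
  unfold besselKernel; fun_prop

lemma besselKernel_neg (μ : ℂ) (β w : ℝ) : besselKernel μ β (-w) = besselKernel (-μ) β w := by
  simp only [besselKernel]
  rw [show -w + β = β - w by ring, show β - -w = w + β by ring]
  congr 1
  push_cast
  ring

lemma integrableOn_besselKernel_Ioi (μ : ℂ) (β : ℝ) :
    IntegrableOn (besselKernel μ β) (Ioi 0) := by
  refine Integrable.mono (integrableOn_gammaKernel_Ioi μ β)
    (continuous_besselKernel μ β).aestronglyMeasurable (ae_of_all _ fun w ↦ ?_)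
  rw [norm_gammaKernel]
  simp only [besselKernel, Complex.norm_exp, Complex.sub_re, Complex.mul_re, Complex.ofReal_re,
    Complex.ofReal_im, mul_zero, sub_zero]
  exact Real.exp_le_exp.2 (sub_le_self _ (Real.exp_pos (β - w)).le)

lemma integrableOn_besselKernel_Iic (μ : ℂ) (β : ℝ) :
    IntegrableOn (besselKernel μ β) (Iic 0) := by
  rw [integrableOn_Iic_iff_integrableOn_Iio]
  have := (integrableOn_besselKernel_Ioi (-μ) β)
  have h := IntegrableOn.comp_neg_Iio (c := 0) (f := besselKernel (-μ) β) (by simpa using this)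
  simpa [besselKernel_neg] using h

lemma integral_besselKernel_eq_add (μ : ℂ) (β : ℝ) :
    ∫ w, besselKernel μ β w = (∫ w in Ioi (0 : ℝ), besselKernel μ β w) +
      ∫ w in Ioi (0 : ℝ), besselKernel (-μ) β w := by
  rw [← setIntegral_univ, ← Set.Iic_union_Ioi (a := 0),
    setIntegral_union (Iic_disjoint_Ioi le_rfl) measurableSet_Ioi
      (integrableOn_besselKernel_Iic μ β) (integrableOn_besselKernel_Ioi μ β), add_comm]
  congr 1
  simp_rw [← besselKernel_neg]
  rw [integral_comp_neg_Ioi, neg_zero]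

lemma norm_gammaKernel_sub_natCast_le (μ : ℂ) (n : ℕ) (β : ℝ) {w : ℝ} (hw : 0 < w) :
    ‖gammaKernel (μ - n) β w‖ ≤ ‖gammaKernel μ β w‖ := by
  rw [norm_gammaKernel, norm_gammaKernel]
  have : (μ - n).re * w ≤ μ.re * w := by
    refine mul_le_mul_of_nonneg_right ?_ hw.le
    simp
  gcongr

lemma hasSum_integral_besselKernel_Ioi (μ : ℂ) (β : ℝ) :
    HasSum (fun n : ℕ ↦ (-(Real.exp β : ℝ) : ℂ) ^ n / (n.factorial : ℂ) * upperGammaLog (μ - n) β)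
      (∫ w in Ioi (0 : ℝ), besselKernel μ β w) := by
  set z : ℂ := -(Real.exp β : ℝ) with hz
  have key := hasSum_integral_of_summable_integral_norm (μ := volume.restrict (Ioi (0 : ℝ)))
    (F := fun (n : ℕ) (w : ℝ) ↦ z ^ n / (n.factorial : ℂ) * gammaKernel (μ - n) β w)
    (fun n ↦ (integrableOn_gammaKernel_Ioi _ β).const_mul _) ?_
  · have h1 (w : ℝ) : ∑' n : ℕ, z ^ n / (n.factorial : ℂ) * gammaKernel (μ - n) β w =
        besselKernel μ β w := by
      have h2 : HasSum (fun m : ℕ ↦ (z * Complex.exp (-w)) ^ m / (m.factorial : ℂ))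
          (Complex.exp (z * Complex.exp (-w))) := by
        rw [Complex.exp_eq_exp_ℂ]; exact NormedSpace.expSeries_div_hasSum_exp _
      refine Eq.trans ?_ ((h2.mul_left (gammaKernel μ β w)).tsum_eq.trans ?_)
      · congr 1 with m
        have : gammaKernel (μ - m) β w = gammaKernel μ β w * Complex.exp (-w) ^ m := by
          rw [gammaKernel, gammaKernel, ← Complex.exp_nat_mul, ← Complex.exp_add]
          congr 1
          ring
        rw [this, mul_pow]
        ring
      · rw [gammaKernel, besselKernel, ← Complex.exp_add, hz, sub_eq_add_neg β w, Real.exp_add β]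
        congr 1
        push_cast
        ring
    simp_rw [h1, integral_const_mul] at key
    exact key
  · simp_rw [norm_mul, norm_div, norm_pow, Complex.norm_natCast, integral_const_mul]
    refine .of_nonneg_of_le (fun n ↦ ?_) (fun n ↦ ?_)
      ((Real.summable_pow_div_factorial ‖z‖).mul_right
        (∫ w in Ioi (0 : ℝ), ‖gammaKernel μ β w‖))
    · have : 0 ≤ ∫ w in Ioi (0 : ℝ), ‖gammaKernel (μ - n) β w‖ :=
        integral_nonneg fun _ ↦ norm_nonneg _
      positivity
    · refine mul_le_mul_of_nonneg_left ?_ (by positivity)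
      exact setIntegral_mono_on (integrableOn_gammaKernel_Ioi _ β).norm
        (integrableOn_gammaKernel_Ioi _ β).norm measurableSet_Ioi
        fun w hw ↦ norm_gammaKernel_sub_natCast_le μ n β hw

lemma summable_double {μ : ℂ} (hμ : μ.im ≠ 0) (z : ℂ) :
    Summable fun p : ℕ × ℕ ↦ z ^ p.1 / (p.1.factorial : ℂ) *
      (z ^ p.2 / (p.2.factorial : ℂ) / (μ - p.1 + p.2)) := by
  have h : Summable fun p : ℕ × ℕ ↦
      ‖z‖ ^ p.1 / (p.1.factorial : ℝ) * (‖z‖ ^ p.2 / (p.2.factorial : ℝ)) :=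
    Summable.mul_of_nonneg (Real.summable_pow_div_factorial ‖z‖)
      (Real.summable_pow_div_factorial ‖z‖) (fun _ ↦ by positivity) (fun _ ↦ by positivity)
  have h1 (p : ℕ × ℕ) : ‖(μ - p.1 + p.2)⁻¹‖ ≤ |μ.im|⁻¹ := by
    simpa using norm_inv_add_natCast_le (s := μ - p.1) (by simpa using hμ) p.2
  refine .of_norm_bounded (h.mul_right |μ.im|⁻¹) fun p ↦ ?_
  have h2 : ‖z ^ p.1 / (p.1.factorial : ℂ) * (z ^ p.2 / (p.2.factorial : ℂ) / (μ - p.1 + p.2))‖ =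
      ‖z‖ ^ p.1 / (p.1.factorial : ℝ) * (‖z‖ ^ p.2 / (p.2.factorial : ℝ)) *
        ‖(μ - p.1 + p.2)⁻¹‖ := by
    simp only [norm_mul, norm_div, norm_pow, Complex.norm_natCast, norm_inv]
    ring
  rw [h2]
  exact mul_le_mul_of_nonneg_left (h1 p) (by positivity)

lemma tsum_double_neg {μ : ℂ} (hμ : μ.im ≠ 0) (z : ℂ) :
    ∑' n : ℕ, z ^ n / (n.factorial : ℂ) * ∑' m : ℕ, z ^ m / (m.factorial : ℂ) / (-μ - n + m) =
      -∑' n : ℕ, z ^ n / (n.factorial : ℂ) *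
        ∑' m : ℕ, z ^ m / (m.factorial : ℂ) / (μ - n + m) := by
  simp_rw [← tsum_mul_left]
  have hcomm := Summable.tsum_comm (f := fun n m : ℕ ↦ z ^ n / (n.factorial : ℂ) *
    (z ^ m / (m.factorial : ℂ) / (μ - n + m))) (summable_double hμ z)
  rw [← hcomm, ← tsum_neg]
  congr 1 with n
  rw [← tsum_neg]
  congr 1 with m
  rw [show -μ - n + m = -(μ - m + n) by ring, div_neg]
  ring

/-- The terms of the power series of a modified Bessel function of the first kind of order `-μ` at
`2 exp β`, without the factor `1 / Γ(1 - μ)`. -/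
def besselTerm (μ : ℂ) (β : ℝ) (n : ℕ) : ℂ :=
  Complex.exp ((-μ + 2 * n) * β) / (n.factorial * poch (1 - μ) n)

lemma hasSum_besselTerm {μ : ℂ} (hμ : μ.im ≠ 0) (β : ℝ) :
    HasSum (fun n ↦ Complex.Gamma μ * besselTerm μ β n)
      ((∫ w in Ioi (0 : ℝ), besselKernel μ β w) +
        ∑' n : ℕ, (-(Real.exp β : ℝ) : ℂ) ^ n / (n.factorial : ℂ) *
          ∑' m : ℕ, (-(Real.exp β : ℝ) : ℂ) ^ m / (m.factorial : ℂ) / (μ - n + m)) := by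
  have h := (hasSum_integral_besselKernel_Ioi μ β).add
    (summable_double hμ (-(Real.exp β : ℝ) : ℂ)).prod.hasSum
  simp_rw [tsum_mul_left] at h
  refine h.congr_fun fun n ↦ ?_
  have hn : (μ - n).im ≠ 0 := by simpa using hμ
  rw [upperGammaLog_eq hn, lowerGammaLog, mul_sub, sub_add_cancel, besselTerm,
    mul_div_assoc', mul_comm _ (poch _ _), ← div_div, mul_div_right_comm, ← Gamma_sub_natCast hμ,
    neg_pow (Complex.ofReal _), Complex.ofReal_exp, ← Complex.exp_nat_mul]
  have : Complex.exp ((-μ + 2 * n) * β) =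
      Complex.exp (n * β) * Complex.exp (-(μ - n) * β) := by
    rw [← Complex.exp_add]
    congr 1
    ring
  rw [this]
  ring

lemma summable_besselTerm {μ : ℂ} (hμ : μ.im ≠ 0) (β : ℝ) : Summable (besselTerm μ β) := by
  have h0 : Complex.Gamma μ ≠ 0 :=
    Complex.Gamma_ne_zero fun m h ↦ hμ (by simpa using congrArg Complex.im h)
  simpa [h0] using (hasSum_besselTerm hμ β).summable.mul_left (Complex.Gamma μ)⁻¹

lemma integral_besselKernel {μ : ℂ} (hμ : μ.im ≠ 0) (β : ℝ) :
    ∫ w, besselKernel μ β w = Complex.Gamma μ * ∑' n, besselTerm μ β n +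
      Complex.Gamma (-μ) * ∑' n, besselTerm (-μ) β n := by
  have hμ' : (-μ).im ≠ 0 := by simpa using hμ
  rw [← tsum_mul_left, ← tsum_mul_left, (hasSum_besselTerm hμ β).tsum_eq,
    (hasSum_besselTerm hμ' β).tsum_eq, tsum_double_neg hμ, integral_besselKernel_eq_add]
  ring

lemma summable_Gamma_mul_pow_div_factorial_sq {c : ℝ} (hc : 0 < c) {x : ℝ} (hx : 0 < x) :
    Summable fun n : ℕ ↦ Real.Gamma (c + n) * x ^ n / (n.factorial * n.factorial : ℝ) := by
  have hpos (n : ℕ) : 0 < Real.Gamma (c + n) := Real.Gamma_pos_of_pos (by positivity)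
  refine summable_of_ratio_test_tendsto_lt_one (l := 0) one_pos
    (Eventually.of_forall fun n ↦ ne_of_gt (by have := hpos n; positivity)) ?_
  have h (n : ℕ) : ‖Real.Gamma (c + (n + 1 : ℕ)) * x ^ (n + 1) /
        ((n + 1).factorial * (n + 1).factorial : ℝ)‖ /
      ‖Real.Gamma (c + n) * x ^ n / (n.factorial * n.factorial : ℝ)‖ =
        x * (c - 1) * (1 / ((n : ℝ) + 1) * (1 / ((n : ℝ) + 1))) + x * (1 / ((n : ℝ) + 1)) := by
    have h1 := hpos n
    have h2 := hpos (n + 1)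
    rw [Real.norm_of_nonneg (by positivity), Real.norm_of_nonneg (by positivity)]
    have h3 : Real.Gamma (c + (n + 1 : ℕ)) = (c + n) * Real.Gamma (c + n) := by
      rw [← Real.Gamma_add_one (by positivity)]
      push_cast
      ring_nf
    rw [h3, Nat.factorial_succ]
    push_cast
    have := n.factorial_pos
    field_simp
    ring
  simp_rw [h]
  have ht := tendsto_one_div_add_atTop_nhds_zero_nat (𝕜 := ℝ)
  simpa using ((ht.mul ht).const_mul (x * (c - 1))).add (ht.const_mul x)

/-- The terms obtained from the Bessel series after multiplication by `gammaKernel c η`. -/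
def laplaceTerm (c : ℝ) (ν : ℂ) (η : ℝ) (n : ℕ) (d : ℝ) : ℂ :=
  gammaKernel (c - ν + n) η d / (n.factorial * poch (1 - 2 * ν) n)

lemma gammaKernel_mul_besselTerm (c : ℝ) (ν : ℂ) (η : ℝ) (n : ℕ) (d : ℝ) :
    gammaKernel c η d * besselTerm (2 * ν) (d / 2) n = laplaceTerm c ν η n d := by
  rw [laplaceTerm, besselTerm, mul_div_assoc', gammaKernel, gammaKernel, ← Complex.exp_add]
  congr 2
  push_cast
  ring

lemma integrable_laplaceTerm {c : ℝ} (hc : 0 < c) {ν : ℂ} (hν : ν.re = 0) (η : ℝ) (n : ℕ) :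
    Integrable (laplaceTerm c ν η n) :=
  (integrable_gammaKernel (by simp [hν]; positivity) η).div_const _

lemma integral_laplaceTerm {c : ℝ} (hc : 0 < c) {ν : ℂ} (hν : ν.re = 0) (η : ℝ) (n : ℕ) :
    ∫ d, laplaceTerm c ν η n d = Complex.Gamma (c - ν) * Complex.exp (-(c - ν) * η) *
      (poch (c - ν) n / poch (1 - 2 * ν) n * Complex.exp (-η) ^ n / (n.factorial : ℂ)) := by
  have h0 (n : ℕ) : (c : ℂ) - ν + n ≠ 0 := fun h ↦ by
    have := congrArg Complex.re h
    simp [hν] at this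
    linarith [(Nat.cast_nonneg n : (0 : ℝ) ≤ n)]
  simp only [laplaceTerm]
  rw [integral_div, integral_gammaKernel (by simp [hν]; positivity), Gamma_add_natCast h0,
    ← Complex.exp_nat_mul]
  have : Complex.exp (-(c - ν + n) * η) =
      Complex.exp (-(c - ν) * η) * Complex.exp (n * -η) := by
    rw [← Complex.exp_add]
    congr 1
    ring
  rw [this]
  field

lemma summable_integral_norm_laplaceTerm {c : ℝ} (hc : 0 < c) {ν : ℂ} (hν : ν.re = 0) (η : ℝ) :
    Summable fun n ↦ ∫ d, ‖laplaceTerm c ν η n d‖ := by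
  refine .of_nonneg_of_le (fun n ↦ integral_nonneg fun _ ↦ norm_nonneg _) (fun n ↦ ?_)
    ((summable_Gamma_mul_pow_div_factorial_sq hc (Real.exp_pos (-η))).mul_left
      (Real.exp (-c * η)))
  have hre : ((c : ℂ) - ν + n).re = c + n := by simp [hν]
  simp only [laplaceTerm, norm_div]
  rw [integral_div, integral_norm_gammaKernel (by rw [hre]; positivity), hre, norm_mul,
    Complex.norm_natCast]
  have h1 := factorial_le_norm_poch (a := 1 - 2 * ν) (by simp [hν]) n
  have h2 : Real.exp (-(c + n) * η) = Real.exp (-c * η) * Real.exp (-η) ^ n := by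
    rw [← Real.exp_nat_mul, ← Real.exp_add]
    congr 1
    ring
  have h3 : 0 < Real.Gamma (c + n) := Real.Gamma_pos_of_pos (by positivity)
  rw [h2, mul_div_assoc', mul_comm (Real.Gamma _), ← mul_assoc]
  gcongr

lemma tsum_integral_laplaceTerm {c : ℝ} (hc : 0 < c) {ν : ℂ} (hν : ν.re = 0) (η : ℝ) :
    ∑' n, ∫ d, laplaceTerm c ν η n d = Complex.Gamma (c - ν) * Complex.exp (-(c - ν) * η) *
      kummerM (c - ν) (1 - 2 * ν) (Complex.exp (-η)) := by
  simp_rw [integral_laplaceTerm hc hν]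
  rw [tsum_mul_left, kummerM]

lemma summable_integral_laplaceTerm {c : ℝ} (hc : 0 < c) {ν : ℂ} (hν : ν.re = 0) (η : ℝ) :
    Summable fun n ↦ ∫ d, laplaceTerm c ν η n d :=
  (summable_integral_norm_laplaceTerm hc hν η).of_norm_bounded
    fun _ ↦ norm_integral_le_integral_norm _

lemma integral_gammaKernel_mul_besselKernel {c : ℝ} (hc : 0 < c) {ν : ℂ} (hν : ν.re = 0) (η : ℝ)
    (hν0 : ν.im ≠ 0) :
    ∫ d, gammaKernel c η d * ∫ w, besselKernel (2 * ν) (d / 2) w =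
      Complex.Gamma (2 * ν) * (Complex.Gamma (c - ν) * Complex.exp (-(c - ν) * η) *
        kummerM (c - ν) (1 - 2 * ν) (Complex.exp (-η))) +
      Complex.Gamma (-(2 * ν)) * (Complex.Gamma (c + ν) * Complex.exp (-(c + ν) * η) *
        kummerM (c + ν) (1 + 2 * ν) (Complex.exp (-η))) := by
  have hν' : (-ν).re = 0 := by simp [hν]
  have hμ : (2 * ν).im ≠ 0 := by simpa [Complex.mul_im] using hν0
  have hμ' : (2 * -ν).im ≠ 0 := by simpa [Complex.mul_im] using hν0
  have e1 (d : ℝ) : gammaKernel c η d * ∫ w, besselKernel (2 * ν) (d / 2) w =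
      ∑' n, (Complex.Gamma (2 * ν) * laplaceTerm c ν η n d +
        Complex.Gamma (-(2 * ν)) * laplaceTerm c (-ν) η n d) := by
    simp_rw [← gammaKernel_mul_besselTerm]
    rw [Summable.tsum_add (((summable_besselTerm hμ _).mul_left _).mul_left _)
      (((summable_besselTerm hμ' _).mul_left _).mul_left _), integral_besselKernel hμ]
    simp_rw [tsum_mul_left, mul_neg]
    ring
  have i1 (n : ℕ) := (integrable_laplaceTerm hc hν η n).const_mul (Complex.Gamma (2 * ν))
  have i2 (n : ℕ) := (integrable_laplaceTerm hc hν' η n).const_mul (Complex.Gamma (-(2 * ν)))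
  have key := hasSum_integral_of_summable_integral_norm (fun n ↦ (i1 n).add (i2 n)) ?_
  · simp_rw [e1]
    refine key.tsum_eq.symm.trans ?_
    simp_rw [Pi.add_apply, integral_add (i1 _) (i2 _), integral_const_mul]
    rw [Summable.tsum_add ((summable_integral_laplaceTerm hc hν η).mul_left _)
      ((summable_integral_laplaceTerm hc hν' η).mul_left _), tsum_mul_left, tsum_mul_left,
      tsum_integral_laplaceTerm hc hν, tsum_integral_laplaceTerm hc hν']
    simp only [sub_neg_eq_add, mul_neg]
  · refine .of_nonneg_of_le (fun n ↦ integral_nonneg fun _ ↦ norm_nonneg _) (fun n ↦ ?_)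
      (((summable_integral_norm_laplaceTerm hc hν η).mul_left ‖Complex.Gamma (2 * ν)‖).add
        ((summable_integral_norm_laplaceTerm hc hν' η).mul_left ‖Complex.Gamma (-(2 * ν))‖))
    rw [← integral_const_mul, ← integral_const_mul,
      ← integral_add ((integrable_laplaceTerm hc hν η n).norm.const_mul _)
        ((integrable_laplaceTerm hc hν' η n).norm.const_mul _)]
    refine integral_mono ((i1 n).add (i2 n)).norm
      (((integrable_laplaceTerm hc hν η n).norm.const_mul _).add
        ((integrable_laplaceTerm hc hν' η n).norm.const_mul _)) fun d ↦ ?_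
    refine (norm_add_le _ _).trans ?_
    simp

lemma Gamma_mul_Gamma_mul_bW_exp (α : ℝ) (hα : α < 1 / 2) {ν : ℂ} (hν : ν.re = 0) {x : ℝ}
    (hx : 0 < x) :
    Complex.Gamma ((1 / 2 - α : ℝ) + ν) * Complex.Gamma ((1 / 2 - α : ℝ) - ν) * bW α ν x =
      Complex.Gamma (2 * ν) * (Complex.Gamma ((1 / 2 - α : ℝ) - ν) *
        Complex.exp (-((1 / 2 - α : ℝ) - ν) * Real.log (2 * x ^ 2)) *
        kummerM ((1 / 2 - α : ℝ) - ν) (1 - 2 * ν) (Complex.exp (-Real.log (2 * x ^ 2)))) +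
      Complex.Gamma (-(2 * ν)) * (Complex.Gamma ((1 / 2 - α : ℝ) + ν) *
        Complex.exp (-((1 / 2 - α : ℝ) + ν) * Real.log (2 * x ^ 2)) *
        kummerM ((1 / 2 - α : ℝ) + ν) (1 + 2 * ν) (Complex.exp (-Real.log (2 * x ^ 2)))) := by
  set c : ℝ := 1 / 2 - α with hc
  set η : ℝ := Real.log (2 * x ^ 2) with hη
  have hc0 : 0 < c := by linarith
  have hG {ν : ℂ} (hν : ν.re = 0) : Complex.Gamma (c + ν) ≠ 0 :=
    Complex.Gamma_ne_zero_of_re_pos (by simpa [hν] using hc0)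
  have hG1 := hG hν
  have hG2 : Complex.Gamma (c - ν) ≠ 0 := by
    rw [sub_eq_add_neg]; exact hG (by simp [hν])
  have hz : ((1 / (2 * x ^ 2) : ℝ) : ℂ) = Complex.exp (-η) := by
    rw [hη, ← Complex.ofReal_neg, ← Complex.ofReal_exp, Real.exp_neg, Real.exp_log (by positivity),
      one_div]
  have hzpow (s : ℂ) : ((1 / (2 * x ^ 2) : ℝ) : ℂ) ^ s = Complex.exp (-η * s) := by
    rw [Complex.cpow_def_of_ne_zero (by exact_mod_cast (by positivity : 1 / (2 * x ^ 2) ≠ 0)),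
      ← Complex.ofReal_log (by positivity), one_div, Real.log_inv]
    push_cast [hη]
    rfl
  have h2x : (2 : ℂ) ^ (α : ℂ) * (x : ℂ) ^ (2 * (α : ℂ)) = Complex.exp (η * α) := by
    rw [Complex.cpow_def_of_ne_zero two_ne_zero, Complex.cpow_def_of_ne_zero
      (by exact_mod_cast hx.ne'), ← Complex.exp_add, hη, Real.log_mul two_ne_zero (by positivity),
      Real.log_pow, ← Complex.ofReal_log hx.le, show (2 : ℂ) = ((2 : ℝ) : ℂ) by norm_num,
      ← Complex.ofReal_log zero_le_two]
    congr 1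
    push_cast
    ring
  have hexp : Complex.exp (1 / (4 * (x : ℂ) ^ 2)) *
      Complex.exp (-((1 / (2 * x ^ 2) : ℝ) : ℂ) / 2) = 1 := by
    have : (1 / (4 * (x : ℂ) ^ 2)) + -((1 / (2 * x ^ 2) : ℝ) : ℂ) / 2 = 0 := by
      push_cast
      ring
    rw [← Complex.exp_add, this, Complex.exp_zero]
  rw [bW, if_neg hx.ne', whittakerW, tricomiU, h2x, hzpow, hzpow, hz]
  rw [hz] at hexp
  have a1 : (1 / 2 - α + ν : ℂ) = c + ν := by push_cast [hc]; ring
  have a2 : (1 / 2 - α + ν + 1 - (1 + 2 * ν) : ℂ) = c - ν := by push_cast [hc]; ring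
  have a3 : (1 / 2 - α + ν - (1 + 2 * ν) + 1 : ℂ) = c - ν := by push_cast [hc]; ring
  rw [a2, a3, a1, show (1 - (1 + 2 * ν) : ℂ) = -(2 * ν) by ring,
    show (1 + 2 * ν - 1 : ℂ) = 2 * ν by ring, show (2 - (1 + 2 * ν) : ℂ) = 1 - 2 * ν by ring]
  have b1 : Complex.exp (η * α) * Complex.exp (-η * (1 / 2 + ν)) =
      Complex.exp (-(c + ν) * η) := by
    rw [← Complex.exp_add]; congr 1; push_cast [hc]; ring
  have b2 : Complex.exp (-(c - ν) * η) =
      Complex.exp (-(c + ν) * η) * Complex.exp (-η * -(2 * ν)) := by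
    rw [← Complex.exp_add]; congr 1; ring
  rw [b2]
  rw [← b1]
  generalize Complex.exp (-η * -(2 * ν)) = E1
  generalize kummerM (c - ν) _ _ = M1
  generalize kummerM (c + ν) _ _ = M2
  generalize Complex.exp (1 / (4 * (x : ℂ) ^ 2)) = X1 at hexp ⊢
  generalize Complex.exp (-Complex.exp (-η) / 2) = X2 at hexp ⊢
  generalize Complex.exp (η * α) = X3
  generalize Complex.exp (-η * (1 / 2 + ν)) = X4
  generalize Complex.Gamma (2 * ν) = G3
  generalize Complex.Gamma (-(2 * ν)) = G4
  generalize Complex.Gamma (c + ν) = G1 at hG1 ⊢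
  generalize Complex.Gamma (c - ν) = G2 at hG2 ⊢
  field_simp
  linear_combination X3 * X4 * (G4 * G1 * M2 + G3 * G2 * E1 * M1) * hexp

/-- The weight on `ℝ × ℝ` whose Fourier transform in the direction `(1, -1)` is the Whittaker
kernel, up to Gamma factors. -/
def whitWeight (c y : ℝ) (z : ℝ × ℝ) : ℝ :=
  Real.exp (c * (z.1 + z.2) - Real.exp z.1 - Real.exp z.2 - y * Real.exp (z.1 + z.2))

lemma whitWeight_pos (c y : ℝ) (z : ℝ × ℝ) : 0 < whitWeight c y z := Real.exp_pos _

@[fun_prop]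
lemma continuous_whitWeight (c : ℝ) : Continuous fun t : ℝ × ℝ × ℝ ↦ whitWeight c t.1 t.2 := by
  unfold whitWeight; fun_prop

lemma whitWeight_zero (c : ℝ) (z : ℝ × ℝ) :
    whitWeight c 0 z = Real.exp (c * z.1 - Real.exp z.1) * Real.exp (c * z.2 - Real.exp z.2) := by
  rw [whitWeight, ← Real.exp_add]
  ring_nf

lemma whitWeight_le (c : ℝ) {y : ℝ} (hy : 0 ≤ y) (z : ℝ × ℝ) :
    whitWeight c y z ≤ whitWeight c 0 z := by
  simp only [whitWeight, zero_mul, sub_zero, Real.exp_le_exp, sub_le_self_iff]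
  positivity

lemma integrable_whitWeight {c : ℝ} (hc : 0 < c) {y : ℝ} (hy : 0 ≤ y) :
    Integrable (whitWeight c y) := by
  have h0 : Integrable (fun w ↦ Real.exp (c * w - Real.exp w)) := by
    simpa [norm_gammaKernel] using (integrable_gammaKernel (s := c) (by simpa using hc) 0).norm
  have h1 : Integrable (whitWeight c 0) :=
    (h0.mul_prod h0).congr (ae_of_all _ fun z ↦ (whitWeight_zero c z).symm)
  refine h1.mono' ((continuous_whitWeight c).comp
    (by fun_prop : Continuous fun z : ℝ × ℝ ↦ (y, z))).aestronglyMeasurable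
    (ae_of_all _ fun z ↦ ?_)
  rw [Real.norm_of_nonneg (whitWeight_pos c y z).le]
  exact whitWeight_le c hy z

/-- The Fourier integrand associated with `whitWeight`. -/
def whitKernel (c y τ : ℝ) (z : ℝ × ℝ) : ℂ :=
  Complex.exp (τ * (z.1 - z.2 : ℝ) * Complex.I) * whitWeight c y z

@[fun_prop]
lemma continuous_whitKernel (c y τ : ℝ) : Continuous (whitKernel c y τ) := by
  unfold whitKernel whitWeight; fun_prop

lemma norm_whitKernel (c y τ : ℝ) (z : ℝ × ℝ) : ‖whitKernel c y τ z‖ = whitWeight c y z := by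
  rw [whitKernel, norm_mul, ← Complex.ofReal_mul, Complex.norm_exp_ofReal_mul_I, one_mul,
    Complex.norm_of_nonneg (whitWeight_pos c y z).le]

lemma integrable_whitKernel {c : ℝ} (hc : 0 < c) {y : ℝ} (hy : 0 ≤ y) (τ : ℝ) :
    Integrable (whitKernel c y τ) :=
  (integrable_whitWeight hc hy).mono' (by fun_prop)
    (ae_of_all _ fun z ↦ (norm_whitKernel c y τ z).le)

lemma integral_whitKernel_zero {c : ℝ} (hc : 0 < c) (τ : ℝ) :
    ∫ z, whitKernel c 0 τ z =
      Complex.Gamma (c + τ * Complex.I) * Complex.Gamma (c - τ * Complex.I) := by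
  have h (z : ℝ × ℝ) : whitKernel c 0 τ z =
      gammaKernel (c + τ * Complex.I) 0 z.1 * gammaKernel (c - τ * Complex.I) 0 z.2 := by
    rw [whitKernel, whitWeight, gammaKernel, gammaKernel, Complex.ofReal_exp, ← Complex.exp_add,
      ← Complex.exp_add]
    congr 1
    push_cast
    simp
    ring
  simp_rw [h]
  rw [volume_eq_prod, integral_prod_mul, integral_gammaKernel (by simpa using hc),
    integral_gammaKernel (by simpa using hc)]
  simp

lemma integral_whitKernel_exp {c : ℝ} (hc : 0 < c) (η τ : ℝ) :
    ∫ z, whitKernel c (Real.exp η) τ z =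
      ∫ d, gammaKernel c η d * ∫ w, besselKernel (2 * (τ * Complex.I)) (d / 2) w := by
  have hmp := measurePreserving_prod_sub_swap (volume : Measure ℝ) (volume : Measure ℝ)
  have hi := integrable_whitKernel hc (Real.exp_pos η).le τ
  rw [volume_eq_prod] at hi ⊢
  rw [← hmp.map_eq, integral_map hmp.aemeasurable (by fun_prop),
    integral_prod (fun z : ℝ × ℝ ↦ whitKernel c (Real.exp η) τ (z.2, z.1 - z.2))
      (hmp.integrable_comp_of_integrable hi)]
  congr 1 with d
  rw [← integral_const_mul, ← integral_add_right_eq_self _ (d / 2)]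
  congr 1 with w
  rw [whitKernel, whitWeight, gammaKernel, besselKernel, Complex.ofReal_exp, ← Complex.exp_add,
    ← Complex.exp_add]
  simp only [add_sub_cancel]
  rw [show d - (w + d / 2) = d / 2 - w by ring, Real.exp_add d η]
  congr 1
  push_cast
  ring

lemma integral_whitKernel {α : ℝ} (hα : α < 1 / 2) {τ : ℝ} (hτ : τ ≠ 0) {x : ℝ} (hx : 0 ≤ x) :
    ∫ z, whitKernel (1 / 2 - α) (2 * x ^ 2) τ z =
      Complex.Gamma ((1 / 2 - α : ℝ) + τ * Complex.I) *
        Complex.Gamma ((1 / 2 - α : ℝ) - τ * Complex.I) * bW α (τ * Complex.I) x := by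
  have hc : 0 < 1 / 2 - α := by linarith
  have hν : (τ * Complex.I).re = 0 := by simp
  rcases hx.eq_or_lt with rfl | hx
  · rw [bW, if_pos rfl, mul_one, ← integral_whitKernel_zero hc]
    simp
  · rw [Gamma_mul_Gamma_mul_bW_exp α hα hν hx, ← Real.exp_log (by positivity : 0 < 2 * x ^ 2),
      integral_whitKernel_exp hc, integral_gammaKernel_mul_besselKernel hc hν _ (by simpa using hτ),
      Real.exp_log (by positivity)]

lemma conj_integral_whitKernel (c y τ : ℝ) :
    starRingEnd ℂ (∫ z, whitKernel c y τ z) = ∫ z, whitKernel c y τ z := by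
  rw [← integral_conj, volume_eq_prod, ← integral_prod_swap]
  congr 1 with z
  rw [whitKernel, whitKernel, map_mul, ← Complex.exp_conj, Complex.conj_ofReal]
  simp only [whitWeight, Prod.fst_swap, Prod.snd_swap, map_mul, Complex.conj_ofReal,
    Complex.conj_I]
  rw [add_comm z.2 z.1, show c * (z.1 + z.2) - Real.exp z.2 - Real.exp z.1 =
    c * (z.1 + z.2) - Real.exp z.1 - Real.exp z.2 by ring]
  congr 2
  push_cast
  ring

lemma integral_whitKernel_neg (c y τ : ℝ) :
    ∫ z, whitKernel c y (-τ) z = ∫ z, whitKernel c y τ z := by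
  rw [← conj_integral_whitKernel c y τ, ← integral_conj]
  congr 1 with z
  rw [whitKernel, whitKernel, map_mul, ← Complex.exp_conj, Complex.conj_ofReal]
  simp

lemma Δl_sq_add_sq (α : ℝ) {τ : ℝ} (hτ : 0 < τ) :
    Δl α ((1 / 2 - α) ^ 2 + τ ^ 2) = τ * Complex.I := by
  have h : (((1 / 2 - α) ^ 2 - ((1 / 2 - α) ^ 2 + τ ^ 2) : ℝ) : ℂ) = (τ * Complex.I) ^ (2 : ℕ) := by
    rw [mul_pow, Complex.I_sq]
    push_cast
    ring
  have harg : (τ * Complex.I).arg = Real.pi / 2 := by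
    rw [Complex.arg_real_mul _ hτ, Complex.arg_I]
  rw [Δl, h, one_div, Complex.pow_cpow_ofNat_inv]
  · rw [harg]
    have := Real.pi_pos
    norm_num
    linarith
  · rw [harg]

lemma integral_whitKernel_eq_bWr {α : ℝ} (hα : α < 1 / 2) {τ : ℝ} (hτ : 0 < τ) {x : ℝ}
    (hx : 0 ≤ x) :
    ∫ z, whitKernel (1 / 2 - α) (2 * x ^ 2) τ z =
      (‖Complex.Gamma ((1 / 2 - α : ℝ) + τ * Complex.I)‖ ^ 2 *
        bWr α (Δl α ((1 / 2 - α) ^ 2 + τ ^ 2)) x : ℝ) := by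
  have h1 := integral_whitKernel hα hτ.ne' hx
  have h2 := conj_integral_whitKernel (1 / 2 - α) (2 * x ^ 2) τ
  have hG : Complex.Gamma ((1 / 2 - α : ℝ) + τ * Complex.I) *
      Complex.Gamma ((1 / 2 - α : ℝ) - τ * Complex.I) =
      ((‖Complex.Gamma ((1 / 2 - α : ℝ) + τ * Complex.I)‖ ^ 2 : ℝ) : ℂ) := by
    rw [Complex.ofReal_pow, ← Complex.mul_conj', ← Complex.Gamma_conj, map_add, map_mul,
      Complex.conj_ofReal, Complex.conj_ofReal, Complex.conj_I, mul_neg, ← sub_eq_add_neg]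
  rw [hG] at h1
  rw [Complex.conj_eq_iff_re] at h2
  rw [Δl_sq_add_sq α hτ, bWr, ← h2, h1, Complex.re_ofReal_mul]

open ProbabilityTheory in
/-- A measure is determined by the values on a left half-line of the moment generating function
of an injective random variable. -/
lemma ext_of_mgf_eqOn_Iio {Ω : Type*} [MeasurableSpace Ω] {P Q : Measure Ω} {X : Ω → ℝ}
    (hX : MeasurableEmbedding X) {t₀ : ℝ} (hP : Iio t₀ ⊆ integrableExpSet X P)
    (hQ : Iio t₀ ⊆ integrableExpSet X Q) (h : EqOn (mgf X P) (mgf X Q) (Iio t₀)) : P = Q := by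
  set U : Set ℂ := {z | z.re < t₀} with hU
  set t : ℝ := t₀ - 1 with ht
  have ht₀ : t < t₀ := by simp [ht]
  have hsub {R : Measure Ω} (hR : Iio t₀ ⊆ integrableExpSet X R) :
      U ⊆ {z | z.re ∈ interior (integrableExpSet X R)} := fun z hz ↦
    interior_maximal hR isOpen_Iio hz
  have hUc : IsPreconnected U := (convex_halfSpace_re_lt t₀).isPreconnected
  have htend : Tendsto (fun r : ℝ ↦ (r : ℂ)) (𝓝[≠] t) (𝓝[≠] (t : ℂ)) :=
    tendsto_nhdsWithin_of_tendsto_nhds_of_eventually_within _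
      (Complex.continuous_ofReal.tendsto t |>.mono_left nhdsWithin_le_nhds)
      (eventually_mem_nhdsWithin.mono fun r hr ↦ by simpa using hr)
  have hfreq : ∃ᶠ z in 𝓝[≠] (t : ℂ), complexMGF X P z = complexMGF X Q z := by
    refine htend.frequently (Eventually.frequently ?_)
    filter_upwards [nhdsWithin_le_nhds (Iio_mem_nhds ht₀)] with r hr
    rw [complexMGF_ofReal, complexMGF_ofReal, h hr]
  have key := (analyticOnNhd_complexMGF.mono (hsub hP)).eqOn_of_preconnected_of_frequently_eq
    (analyticOnNhd_complexMGF.mono (hsub hQ)) hUc (by simpa [hU] using ht₀) hfreq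
  have hXm : Measurable X := hX.measurable
  have hm : Measurable fun ω ↦ ENNReal.ofReal (Real.exp (t * X ω)) := by fun_prop
  have hfin {R : Measure Ω} (hR : Iio t₀ ⊆ integrableExpSet X R) :
      IsFiniteMeasure (R.withDensity fun ω ↦ ENNReal.ofReal (Real.exp (t * X ω))) :=
    isFiniteMeasure_withDensity_ofReal (hR ht₀ : Integrable _ R).2
  have := hfin hP
  have := hfin hQ
  have hchar (R : Measure Ω) (s : ℝ) :
      charFun ((R.withDensity fun ω ↦ ENNReal.ofReal (Real.exp (t * X ω))).map X) s =
        complexMGF X R (t + s * Complex.I) := by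
    rw [← complexMGF_mul_I hXm.aemeasurable, complexMGF, complexMGF,
      integral_withDensity_eq_integral_toReal_smul hm (by simp)]
    congr 1 with ω
    rw [ENNReal.toReal_ofReal (Real.exp_pos _).le, Complex.real_smul, Complex.ofReal_exp,
      ← Complex.exp_add]
    congr 1
    push_cast
    ring
  have hmap : (P.withDensity fun ω ↦ ENNReal.ofReal (Real.exp (t * X ω))).map X =
      (Q.withDensity fun ω ↦ ENNReal.ofReal (Real.exp (t * X ω))).map X := by
    refine Measure.ext_of_charFun (funext fun s ↦ ?_)
    rw [hchar, hchar]
    exact key (by simpa [hU] using ht₀)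
  have hdens := congrArg (Measure.comap X) hmap
  rw [hX.comap_map, hX.comap_map] at hdens
  have hinv (R : Measure Ω) := withDensity_inv_same (μ := R) hm
    (ae_of_all _ fun ω ↦ by simp [Real.exp_pos])
    (ae_of_all _ fun ω ↦ by simp)
  rw [← hinv P, hdens, hinv Q]

section

/-- The finite measure on `ℝ × (ℝ × ℝ)` obtained by weighting `μ ⊗ dp dq` with `whitWeight`. -/
def whitMeasure (c : ℝ) (μ : Measure ℝ) : Measure (ℝ × ℝ × ℝ) :=
  (μ.prod volume).withDensity fun t ↦ ENNReal.ofReal (whitWeight c (2 * t.1 ^ 2) t.2)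

lemma continuous_whitWeight_sq (c : ℝ) :
    Continuous fun t : ℝ × ℝ × ℝ ↦ whitWeight c (2 * t.1 ^ 2) t.2 := by
  unfold whitWeight; fun_prop

lemma measurable_whitWeight_sq (c : ℝ) :
    Measurable fun t : ℝ × ℝ × ℝ ↦ ENNReal.ofReal (whitWeight c (2 * t.1 ^ 2) t.2) :=
  (continuous_whitWeight_sq c).measurable.ennreal_ofReal

variable {c : ℝ}

lemma integrable_whitWeight_sq (hc : 0 < c) (μ : Measure ℝ) [IsFiniteMeasure μ] :
    Integrable (fun t : ℝ × ℝ × ℝ ↦ whitWeight c (2 * t.1 ^ 2) t.2) (μ.prod volume) := by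
  refine ((integrable_whitWeight hc le_rfl).comp_snd μ).mono'
    (continuous_whitWeight_sq c).aestronglyMeasurable (ae_of_all _ fun t ↦ ?_)
  rw [Real.norm_of_nonneg (whitWeight_pos _ _ _).le]
  exact whitWeight_le c (by positivity) _

lemma isFiniteMeasure_whitMeasure (hc : 0 < c) (μ : Measure ℝ) [IsFiniteMeasure μ] :
    IsFiniteMeasure (whitMeasure c μ) :=
  isFiniteMeasure_withDensity_ofReal (integrable_whitWeight_sq hc μ).2

lemma charFun_map_whitMeasure (hc : 0 < c) (μ : Measure ℝ) [IsFiniteMeasure μ] (s : ℝ) :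
    charFun ((whitMeasure c μ).map fun t ↦ t.2.1 - t.2.2) s =
      ∫ x, (∫ z, whitKernel c (2 * x ^ 2) s z) ∂μ := by
  have h1 : (∫ t, Complex.exp (s * (t.2.1 - t.2.2 : ℝ) * Complex.I) ∂(whitMeasure c μ)) =
      ∫ t, whitKernel c (2 * t.1 ^ 2) s t.2 ∂(μ.prod volume) := by
    rw [whitMeasure, integral_withDensity_eq_integral_toReal_smul
      (measurable_whitWeight_sq c) (by simp)]
    congr 1 with t
    rw [ENNReal.toReal_ofReal (whitWeight_pos _ _ _).le, Complex.real_smul, whitKernel, mul_comm]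
  have h2 : Integrable (fun t : ℝ × ℝ × ℝ ↦ whitKernel c (2 * t.1 ^ 2) s t.2) (μ.prod volume) :=
    (integrable_whitWeight_sq hc μ).mono'
      (by unfold whitKernel whitWeight; fun_prop)
      (ae_of_all _ fun t ↦ (norm_whitKernel _ _ _ _).le)
  rw [charFun_apply_real, integral_map (by fun_prop) (by fun_prop), h1, integral_prod _ h2]

lemma charFun_map_whitMeasure_eq_iwHat {α : ℝ} (hα : α < 1 / 2) {μ : Measure ℝ}
    [IsFiniteMeasure μ] (hμ : OnHalfLine μ) {s : ℝ} (hs : 0 < s) :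
    charFun ((whitMeasure (1 / 2 - α) μ).map fun t ↦ t.2.1 - t.2.2) s =
      (‖Complex.Gamma ((1 / 2 - α : ℝ) + s * Complex.I)‖ ^ 2 *
        iwHat α μ ((1 / 2 - α) ^ 2 + s ^ 2) : ℝ) := by
  have hae : ∀ᵐ x ∂μ, 0 ≤ x := by
    rw [ae_iff]; simpa [OnHalfLine] using hμ
  rw [charFun_map_whitMeasure (by linarith), iwHat, ← integral_const_mul, ← integral_complex_ofReal]
  refine integral_congr_ae (hae.mono fun x hx ↦ ?_)
  exact integral_whitKernel_eq_bWr hα hs hx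

lemma map_whitMeasure_eq {α : ℝ} (hα : α < 1 / 2) {μ₁ μ₂ : Measure ℝ}
    [IsFiniteMeasure μ₁] [IsFiniteMeasure μ₂] (hμ₁ : OnHalfLine μ₁) (hμ₂ : OnHalfLine μ₂)
    (h : ∀ lam : ℝ, 0 ≤ lam → iwHat α μ₁ lam = iwHat α μ₂ lam) :
    ((whitMeasure (1 / 2 - α) μ₁).map fun t ↦ t.2.1 - t.2.2) =
      (whitMeasure (1 / 2 - α) μ₂).map fun t ↦ t.2.1 - t.2.2 := by
  have hc : 0 < 1 / 2 - α := by linarith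
  have := isFiniteMeasure_whitMeasure hc μ₁
  have := isFiniteMeasure_whitMeasure hc μ₂
  have hpos {s : ℝ} (hs : 0 < s) :
      charFun ((whitMeasure (1 / 2 - α) μ₁).map fun t ↦ t.2.1 - t.2.2) s =
        charFun ((whitMeasure (1 / 2 - α) μ₂).map fun t ↦ t.2.1 - t.2.2) s := by
    rw [charFun_map_whitMeasure_eq_iwHat hα hμ₁ hs, charFun_map_whitMeasure_eq_iwHat hα hμ₂ hs,
      h _ (by positivity)]
  refine Measure.ext_of_charFun (Continuous.ext_on (dense_compl_singleton (0 : ℝ))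
    continuous_charFun continuous_charFun fun s hs ↦ ?_)
  rcases lt_or_gt_of_ne hs with hs | hs
  · have h' := hpos (neg_pos.2 hs)
    rw [charFun_map_whitMeasure hc, charFun_map_whitMeasure hc] at h' ⊢
    simpa only [integral_whitKernel_neg] using h'
  · exact hpos hs

lemma lintegral_prod_eq_lintegral_add_sub {F : ℝ × ℝ → ENNReal} (hF : Measurable F) :
    ∫⁻ z, F z = ∫⁻ v, ∫⁻ b, F (b + v / 2, b - v / 2) := by
  rw [volume_eq_prod, lintegral_prod_symm _ hF.aemeasurable]
  have h1 (q : ℝ) : ∫⁻ p, F (p, q) = ∫⁻ v, F (q + v, q) :=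
    (lintegral_add_left_eq_self (fun p ↦ F (p, q)) q).symm
  simp_rw [h1]
  rw [lintegral_lintegral_swap (by fun_prop)]
  congr 1 with v
  rw [← lintegral_sub_right_eq_self _ (v / 2)]
  congr 1 with b
  congr 2
  ring

section

open ProbabilityTheory

lemma integrable_exp_mul_sq (μ : Measure ℝ) [IsFiniteMeasure μ] {t : ℝ} (ht : t ≤ 0) :
    Integrable (fun x ↦ Real.exp (t * x ^ 2)) μ := by
  refine (integrable_const (1 : ℝ)).mono' (by fun_prop) (ae_of_all _ fun x ↦ ?_)
  rw [Real.norm_of_nonneg (Real.exp_pos _).le, Real.exp_le_one_iff]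
  exact mul_nonpos_of_nonpos_of_nonneg ht (sq_nonneg x)

lemma Iic_subset_integrableExpSet_sq (μ : Measure ℝ) [IsFiniteMeasure μ] :
    Iic 0 ⊆ integrableExpSet (fun x ↦ x ^ 2) μ :=
  fun _ ht ↦ integrable_exp_mul_sq μ ht

/-- The density of the mixing measure through which the laws of `whitMeasure` are Laplace
transforms. -/
def mixDensity (c : ℝ) (μ : Measure ℝ) (b : ℝ) : ℝ :=
  Real.exp (2 * c * b) * mgf (fun x ↦ x ^ 2) μ (-2 * Real.exp (2 * b))

lemma mixDensity_nonneg (c : ℝ) (μ : Measure ℝ) (b : ℝ) : 0 ≤ mixDensity c μ b :=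
  mul_nonneg (Real.exp_pos _).le mgf_nonneg

lemma continuous_mixDensity (c : ℝ) (μ : Measure ℝ) [IsFiniteMeasure μ] :
    Continuous (mixDensity c μ) := by
  have h1 : ContinuousOn (mgf (fun x ↦ x ^ 2) μ) (Iio 0) := continuousOn_mgf.mono <|
    interior_maximal (Iio_subset_Iic_self.trans (Iic_subset_integrableExpSet_sq μ)) isOpen_Iio
  have h2 : Continuous fun b : ℝ ↦ mgf (fun x ↦ x ^ 2) μ (-2 * Real.exp (2 * b)) :=
    h1.comp_continuous (by fun_prop) fun b ↦ by simp [Real.exp_pos]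
  unfold mixDensity
  fun_prop

lemma mixDensity_le (c : ℝ) (μ : Measure ℝ) [IsFiniteMeasure μ] (b : ℝ) :
    mixDensity c μ b ≤ μ.real univ * Real.exp (2 * c * b) := by
  rw [mixDensity, mul_comm]
  refine mul_le_mul_of_nonneg_right ?_ (Real.exp_pos _).le
  have h1 : ∫ _, (1 : ℝ) ∂μ = μ.real univ := by simp
  rw [mgf, ← h1]
  refine integral_mono (integrable_exp_mul_sq μ (by simp [(Real.exp_pos _).le]))
    (integrable_const _) fun x ↦ ?_
  simp only [Real.exp_le_one_iff]
  have := Real.exp_pos (2 * b)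
  nlinarith [mul_nonneg this.le (sq_nonneg x)]

lemma integrable_mixDensity_mul_exp (hc : 0 < c) (μ : Measure ℝ) [IsFiniteMeasure μ] {t : ℝ}
    (ht : t < 0) : Integrable fun b ↦ mixDensity c μ b * Real.exp (t * Real.exp b) := by
  have h1 := (integrable_gammaKernel (s := (2 * c : ℝ)) (by simpa using hc)
    (Real.log (-t))).norm.const_mul (μ.real univ)
  refine h1.mono' ((continuous_mixDensity c μ).mul (by fun_prop)).aestronglyMeasurable
    (ae_of_all _ fun b ↦ ?_)
  rw [Real.norm_of_nonneg (mul_nonneg (mixDensity_nonneg c μ b) (Real.exp_pos _).le),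
    norm_gammaKernel, Complex.ofReal_re, Real.exp_add, Real.exp_log (neg_pos.2 ht),
    show 2 * c * b - Real.exp b * -t = 2 * c * b + t * Real.exp b by ring, Real.exp_add,
    ← mul_assoc]
  exact mul_le_mul_of_nonneg_right (mixDensity_le c μ b) (Real.exp_pos _).le

/-- The mixing measure with density `mixDensity`. -/
def mixMeasure (c : ℝ) (μ : Measure ℝ) : Measure ℝ :=
  volume.withDensity fun b ↦ ENNReal.ofReal (mixDensity c μ b)

lemma integrable_exp_mixMeasure (hc : 0 < c) (μ : Measure ℝ) [IsFiniteMeasure μ] {t : ℝ}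
    (ht : t < 0) : Integrable (fun b ↦ Real.exp (t * Real.exp b)) (mixMeasure c μ) := by
  rw [mixMeasure, integrable_withDensity_iff_integrable_smul'
    (continuous_mixDensity c μ).measurable.ennreal_ofReal (by simp)]
  simpa only [ENNReal.toReal_ofReal (mixDensity_nonneg _ _ _), smul_eq_mul] using
    integrable_mixDensity_mul_exp hc μ ht

lemma mgf_exp_mixMeasure (c : ℝ) (μ : Measure ℝ) [IsFiniteMeasure μ] (t : ℝ) :
    mgf Real.exp (mixMeasure c μ) t = ∫ b, mixDensity c μ b * Real.exp (t * Real.exp b) := by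
  rw [mgf, mixMeasure, integral_withDensity_eq_integral_toReal_smul
    (continuous_mixDensity c μ).measurable.ennreal_ofReal (by simp)]
  simp only [ENNReal.toReal_ofReal (mixDensity_nonneg _ _ _), smul_eq_mul]

lemma lintegral_whitWeight_sq (c : ℝ) (μ : Measure ℝ) [IsFiniteMeasure μ] (v b : ℝ) :
    ∫⁻ x, ENNReal.ofReal (whitWeight c (2 * x ^ 2) (b + v / 2, b - v / 2)) ∂μ =
      ENNReal.ofReal (mixDensity c μ b * Real.exp (-2 * Real.cosh (v / 2) * Real.exp b)) := by
  have h (x : ℝ) : whitWeight c (2 * x ^ 2) (b + v / 2, b - v / 2) =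
      Real.exp (2 * c * b) * Real.exp (-2 * Real.cosh (v / 2) * Real.exp b) *
        Real.exp (-2 * Real.exp (2 * b) * x ^ 2) := by
    rw [whitWeight, ← Real.exp_add, ← Real.exp_add, Real.cosh_eq]
    simp only [add_add_sub_cancel]
    rw [Real.exp_add b, sub_eq_add_neg b, Real.exp_add b, two_mul b]
    ring_nf
  simp_rw [h]
  rw [← ofReal_integral_eq_lintegral_ofReal
    ((integrable_exp_mul_sq μ (by simp [(Real.exp_pos _).le])).const_mul _)
    (ae_of_all _ fun x ↦ by positivity), integral_const_mul, mixDensity, mgf]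
  ring_nf

lemma lintegral_indicator_preimage_sub {s : Set ℝ} (hs : MeasurableSet s)
    {L : ℝ × ℝ → ENNReal} (hL : Measurable L) :
    ∫⁻ z in (fun z : ℝ × ℝ ↦ z.1 - z.2) ⁻¹' s, L z =
      ∫⁻ v in s, ∫⁻ b, L (b + v / 2, b - v / 2) := by
  have hV : Measurable fun z : ℝ × ℝ ↦ z.1 - z.2 := by fun_prop
  rw [← lintegral_indicator (hV hs), ← lintegral_indicator hs,
    lintegral_prod_eq_lintegral_add_sub (hL.indicator (hV hs))]
  congr 1 with v
  by_cases hv : v ∈ s <;> simp [indicator, hv]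

lemma map_whitMeasure (hc : 0 < c) (μ : Measure ℝ) [IsFiniteMeasure μ] :
    ((whitMeasure c μ).map fun t ↦ t.2.1 - t.2.2) = volume.withDensity fun v ↦
      ENNReal.ofReal (mgf Real.exp (mixMeasure c μ) (-2 * Real.cosh (v / 2))) := by
  have hV : Measurable fun z : ℝ × ℝ ↦ z.1 - z.2 := by fun_prop
  have hV' : Measurable fun t : ℝ × ℝ × ℝ ↦ t.2.1 - t.2.2 := by fun_prop
  have hL : Measurable fun z : ℝ × ℝ ↦
      ∫⁻ x, ENNReal.ofReal (whitWeight c (2 * x ^ 2) z) ∂μ :=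
    (measurable_whitWeight_sq c).lintegral_prod_left'
  ext s hs
  have hpre : (fun t : ℝ × ℝ × ℝ ↦ t.2.1 - t.2.2) ⁻¹' s =
      univ ×ˢ ((fun z : ℝ × ℝ ↦ z.1 - z.2) ⁻¹' s) := by ext; simp
  rw [map_apply hV' hs, whitMeasure, withDensity_apply _ (hV' hs), withDensity_apply _ hs, hpre,
    ← Measure.prod_restrict, Measure.restrict_univ,
    lintegral_prod_symm _ (measurable_whitWeight_sq c).aemeasurable,
    lintegral_indicator_preimage_sub hs hL]
  congr 1 with v
  have hcosh : -2 * Real.cosh (v / 2) < 0 := by have := Real.cosh_pos (v / 2); linarith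
  simp_rw [lintegral_whitWeight_sq]
  rw [← ofReal_integral_eq_lintegral_ofReal (integrable_mixDensity_mul_exp hc μ hcosh)
    (ae_of_all _ fun b ↦ mul_nonneg (mixDensity_nonneg c μ b) (Real.exp_pos _).le),
    ← mgf_exp_mixMeasure]

lemma continuous_mgf_cosh (hc : 0 < c) (μ : Measure ℝ) [IsFiniteMeasure μ] :
    Continuous fun v ↦ mgf Real.exp (mixMeasure c μ) (-2 * Real.cosh (v / 2)) := by
  have h1 : ContinuousOn (mgf Real.exp (mixMeasure c μ)) (Iio 0) := continuousOn_mgf.mono <|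
    interior_maximal (fun t ht ↦ integrable_exp_mixMeasure hc μ ht) isOpen_Iio
  exact h1.comp_continuous (by fun_prop) fun v ↦ by simp [Real.cosh_pos]

lemma mixMeasure_eq_of_map_whitMeasure_eq (hc : 0 < c) {μ₁ μ₂ : Measure ℝ}
    [IsFiniteMeasure μ₁] [IsFiniteMeasure μ₂]
    (h : ((whitMeasure c μ₁).map fun t ↦ t.2.1 - t.2.2) =
      (whitMeasure c μ₂).map fun t ↦ t.2.1 - t.2.2) :
    mixMeasure c μ₁ = mixMeasure c μ₂ := by
  rw [map_whitMeasure hc, map_whitMeasure hc, withDensity_eq_iff_of_sigmaFinite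
    (continuous_mgf_cosh hc μ₁).measurable.ennreal_ofReal.aemeasurable
    (continuous_mgf_cosh hc μ₂).measurable.ennreal_ofReal.aemeasurable] at h
  have h' : (fun v ↦ mgf Real.exp (mixMeasure c μ₁) (-2 * Real.cosh (v / 2))) =
      fun v ↦ mgf Real.exp (mixMeasure c μ₂) (-2 * Real.cosh (v / 2)) := by
    refine (Continuous.ae_eq_iff_eq volume (continuous_mgf_cosh hc μ₁)
      (continuous_mgf_cosh hc μ₂)).1 (h.mono fun v hv ↦ ?_)
    exact (ENNReal.ofReal_eq_ofReal_iff mgf_nonneg mgf_nonneg).1 hv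
  refine ext_of_mgf_eqOn_Iio (t₀ := -2)
    (Real.continuous_exp.measurableEmbedding Real.exp_injective)
    (fun t ht ↦ integrable_exp_mixMeasure hc μ₁ (lt_trans ht (by norm_num)))
    (fun t ht ↦ integrable_exp_mixMeasure hc μ₂ (lt_trans ht (by norm_num))) fun t ht ↦ ?_
  have h1 : 1 ≤ -t / 2 := by rw [mem_Iio] at ht; linarith
  have := congrFun h' (2 * Real.arcosh (-t / 2))
  simpa only [mul_div_cancel_left₀ _ (two_ne_zero' ℝ), Real.cosh_arcosh h1,
    show -2 * (-t / 2) = t by ring] using this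

lemma eq_of_mixMeasure_eq {μ₁ μ₂ : Measure ℝ}
    [IsFiniteMeasure μ₁] [IsFiniteMeasure μ₂] (hμ₁ : OnHalfLine μ₁) (hμ₂ : OnHalfLine μ₂)
    (h : mixMeasure c μ₁ = mixMeasure c μ₂) : μ₁ = μ₂ := by
  rw [mixMeasure, mixMeasure, withDensity_eq_iff_of_sigmaFinite
    (continuous_mixDensity c μ₁).measurable.ennreal_ofReal.aemeasurable
    (continuous_mixDensity c μ₂).measurable.ennreal_ofReal.aemeasurable] at h
  have h' : mixDensity c μ₁ = mixDensity c μ₂ :=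
    (Continuous.ae_eq_iff_eq volume (continuous_mixDensity c μ₁)
      (continuous_mixDensity c μ₂)).1 (h.mono fun b hb ↦
        (ENNReal.ofReal_eq_ofReal_iff (mixDensity_nonneg _ _ _) (mixDensity_nonneg _ _ _)).1 hb)
  have hinj : Function.Injective fun x : ℝ ↦ x * |x| := by
    refine StrictMono.injective fun x y hxy ↦ ?_
    rcases abs_cases x with hx | hx <;> rcases abs_cases y with hy | hy <;>
      simp only [hx.1, hy.1] <;> nlinarith
  have hae {μ : Measure ℝ} (hμ : OnHalfLine μ) :
      (fun x : ℝ ↦ x * |x|) =ᵐ[μ] fun x ↦ x ^ 2 := by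
    have : ∀ᵐ x ∂μ, 0 ≤ x := by
      rw [ae_iff]; simpa [OnHalfLine] using hμ
    filter_upwards [this] with x hx
    rw [abs_of_nonneg hx, sq]
  have hset {μ : Measure ℝ} [IsFiniteMeasure μ] (hμ : OnHalfLine μ) :
      Iio 0 ⊆ integrableExpSet (fun x : ℝ ↦ x * |x|) μ := by
    refine fun t ht ↦ (integrable_exp_mul_sq μ (le_of_lt ht)).congr ?_
    filter_upwards [hae hμ] with x hx
    rw [hx]
  refine ext_of_mgf_eqOn_Iio
    (Continuous.measurableEmbedding (by fun_prop) hinj) (hset hμ₁) (hset hμ₂) fun t ht ↦ ?_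
  rw [mgf_congr (hae hμ₁), mgf_congr (hae hμ₂)]
  have h1 : 0 < -t / 2 := by rw [mem_Iio] at ht; linarith
  have h2 : -2 * Real.exp (2 * (Real.log (-t / 2) / 2)) = t := by
    rw [mul_div_cancel₀ _ (two_ne_zero' ℝ), Real.exp_log h1]
    ring
  have := congrFun h' (Real.log (-t / 2) / 2)
  rw [mixDensity, mixDensity, h2] at this
  exact mul_left_cancel₀ (Real.exp_ne_zero _) this

end

end

/-- Proposition 4.4(ii): for `α < 1/2`, every finite positive Borel measure on
`[0,∞)` is uniquely determined by its index Whittaker transform. -/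
theorem iwHat_injective (α : ℝ) (hα : α < 1 / 2) (μ₁ μ₂ : Measure ℝ)
    (h₁ : IsFiniteMeasure μ₁) (h₂ : IsFiniteMeasure μ₂)
    (hh₁ : OnHalfLine μ₁) (hh₂ : OnHalfLine μ₂)
    (h : ∀ lam : ℝ, 0 ≤ lam → iwHat α μ₁ lam = iwHat α μ₂ lam) :
    μ₁ = μ₂ := by
  exact eq_of_mixMeasure_eq hh₁ hh₂ (mixMeasure_eq_of_map_whitMeasure_eq (by linarith)
    (map_whitMeasure_eq hα hh₁ hh₂ h))

end
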